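/- Let c ≠ 0 and Λ ≠ 0 be real numbers. On ℝ²×ℝ² with coordinates (x¹,x²,ξ₁,ξ₂), let Γ be the torsion-free connection with Γ^1_{11} = c x¹(x²)², Γ^2_{12} = Γ^2_{21} = −c x¹(x²)², Γ^2_{22} = c (x¹)²x², Γ^1_{12} = Γ^1_{21} = −c (x¹)²x², Γ^1_{22} = c (x¹)³, Γ^2_{11} = c (x²)³, and let g be the metric with components g(∂_{ξ_i},∂_{x^j}) = ½δ_{ij}, g(∂_{x^i},∂_{x^j}) = Λξ_iξ_j + (4c/Λ) v_i v_j − Σ_k Γ^k_{ij}ξ_k where (v₁,v₂) = (x²,−x¹), and g(∂_{ξ_i},∂_{ξ_j}) = 0 (this is the cohomogeneity-one metric g = dξ_i⊙dx^i + Λ(ξ_i dx^i)² + (4c/Λ)(x²dx¹ − x¹dx²)² − Γ^k_{ij}ξ_k dx^i⊙dx^j). Then each of the three vector fields K₁ = x¹∂_{x¹} − x²∂_{x²} − ξ₁∂_{ξ₁} + ξ₂∂_{ξ₂}, K₂ = 2x¹∂_{x²} − 2ξ₂∂_{ξ₁}, K₃ = 2ξ₁∂_{ξ₂} − 2x²∂_{x¹}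 is a Killing vector field for g: ℒ_{K_α} g = 0 for α = 1,2,3. -/

import Mathlib

noncomputable section
open Matrix

/-- Points of the plane. -/
abbrev Pt2 : Type := Fin 2 → ℝ
/-- Points of `ℝ² × ℝ²`, coordinates `(x¹, x², ξ₁, ξ₂)`. -/
abbrev Pt4 : Type := Fin 4 → ℝ

/-- Partial derivative of a function on `ℝ⁴`. -/
def pd4 (a : Fin 4) (f : Pt4 → ℝ) (p : Pt4) : ℝ := fderiv ℝ f p (Pi.single a 1)

/-- Base point `(x¹,x²)` of a point of `ℝ² × ℝ²`. -/
def bpt (p : Pt4) : Pt2 := ![p 0, p 1]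
/-- Fibre coordinates `(ξ₁,ξ₂)` of a point of `ℝ² × ℝ²`. -/
def fib (p : Pt4) : Fin 2 → ℝ := ![p 2, p 3]

/-- The submaximal connection: `Γ^1_{11} = c x¹(x²)²`, `Γ^2_{12} = Γ^2_{21} = −c x¹(x²)²`,
`Γ^2_{22} = c(x¹)²x²`, `Γ^1_{12} = Γ^1_{21} = −c(x¹)²x²`, `Γ^1_{22} = c(x¹)³`,
`Γ^2_{11} = c(x²)³`; the first index of `submaxConn c` is the upper index. -/
def submaxConn (c : ℝ) : Fin 2 → Fin 2 → Fin 2 → Pt2 → ℝ :=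
  ![![![fun x => c * x 0 * (x 1) ^ 2, fun x => -(c * (x 0) ^ 2 * x 1)],
     ![fun x => -(c * (x 0) ^ 2 * x 1), fun x => c * (x 0) ^ 3]],
    ![![fun x => c * (x 1) ^ 3, fun x => -(c * x 0 * (x 1) ^ 2)],
     ![fun x => -(c * x 0 * (x 1) ^ 2), fun x => c * (x 0) ^ 2 * x 1]]]

/-- The one-form `(v₁, v₂) = (x², −x¹)`, i.e. `x²dx¹ − x¹dx²`. -/
def vform : Fin 2 → Pt2 → ℝ := ![fun x => x 1, fun x => -(x 0)]

/-- The cohomogeneity-one metric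
`g = dξ_i⊙dx^i + Λ(ξ_i dx^i)² + (4c/Λ)(x²dx¹ − x¹dx²)² − Γ^k_{ij}ξ_k dx^i⊙dx^j`,
as a symmetric `4×4` matrix in the coordinates `(x¹,x²,ξ₁,ξ₂)`. -/
def submaxMetric (c Λ : ℝ) (p : Pt4) : Matrix (Fin 4) (Fin 4) ℝ :=
  let A : Fin 2 → Fin 2 → ℝ := fun i j =>
    Λ * fib p i * fib p j + (4 * c / Λ) * vform i (bpt p) * vform j (bpt p)
      - ∑ k, submaxConn c k i j (bpt p) * fib p k
  !![A 0 0, A 0 1, 1/2, 0;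
     A 1 0, A 1 1, 0, 1/2;
     1/2, 0, 0, 0;
     0, 1/2, 0, 0]

/-- Lie derivative `(ℒ_X T)_{ab} = Σ_c (X^c ∂_c T_{ab} + T_{cb} ∂_a X^c + T_{ac} ∂_b X^c)`
of a covariant 2-tensor on an open subset of `ℝ⁴`. -/
def lieT (X : Fin 4 → Pt4 → ℝ) (T : Pt4 → Matrix (Fin 4) (Fin 4) ℝ)
    (a b : Fin 4) (p : Pt4) : ℝ :=
  ∑ c, (X c p * pd4 c (fun q => T q a b) p
    + T p c b * pd4 a (X c) p + T p a c * pd4 b (X c) p)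

/-- The vector field `K₁ = x¹∂_{x¹} − x²∂_{x²} − ξ₁∂_{ξ₁} + ξ₂∂_{ξ₂}`. -/
def K1 : Fin 4 → Pt4 → ℝ :=
  ![fun p => p 0, fun p => -(p 1), fun p => -(p 2), fun p => p 3]
/-- The vector field `K₂ = 2x¹∂_{x²} − 2ξ₂∂_{ξ₁}`. -/
def K2 : Fin 4 → Pt4 → ℝ :=
  ![fun _ => 0, fun p => 2 * p 0, fun p => -(2 * p 3), fun _ => 0]
/-- The vector field `K₃ = 2ξ₁∂_{ξ₂} − 2x²∂_{x¹}`. -/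
def K3 : Fin 4 → Pt4 → ℝ :=
  ![fun p => -(2 * p 1), fun _ => 0, fun _ => 0, fun p => 2 * p 2]

theorem pd4_coord (a i : Fin 4) (p : Pt4) :
    pd4 a (fun q => q i) p = if i = a then 1 else 0 := by
  unfold pd4
  rw [(hasFDerivAt_apply i p).fderiv]
  simp [Pi.single_apply]

theorem pd4_const (a : Fin 4) (r : ℝ) (p : Pt4) : pd4 a (fun _ => r) p = 0 := by
  simp [pd4]

theorem pd4_neg (a : Fin 4) (f : Pt4 → ℝ) (p : Pt4) :
    pd4 a (fun q => -(f q)) p = -(pd4 a f p) := by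
  simp [pd4, fderiv_fun_neg]

theorem pd4_add (a : Fin 4) (f g : Pt4 → ℝ) (p : Pt4)
    (hf : DifferentiableAt ℝ f p) (hg : DifferentiableAt ℝ g p) :
    pd4 a (fun q => f q + g q) p = pd4 a f p + pd4 a g p := by
  simp [pd4, fderiv_fun_add hf hg]

theorem pd4_mul (a : Fin 4) (f g : Pt4 → ℝ) (p : Pt4)
    (hf : DifferentiableAt ℝ f p) (hg : DifferentiableAt ℝ g p) :
    pd4 a (fun q => f q * g q) p = f p * pd4 a g p + g p * pd4 a f p := by
  simp [pd4, fderiv_fun_mul hf hg]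

/-- The `dx dx` block is `Λ ξ_i ξ_j + (4c/Λ - c (x·ξ)) v_i v_j`. -/
theorem submaxMetric_eq (c Λ : ℝ) : submaxMetric c Λ = fun p =>
    !![Λ * (p 2 * p 2) + (4 * c / Λ + (-c) * (p 0 * p 2 + p 1 * p 3)) * (p 1 * p 1),
       Λ * (p 2 * p 3) + (4 * c / Λ + (-c) * (p 0 * p 2 + p 1 * p 3)) * (-(p 0 * p 1)), 1/2, 0;
       Λ * (p 2 * p 3) + (4 * c / Λ + (-c) * (p 0 * p 2 + p 1 * p 3)) * (-(p 0 * p 1)),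
       Λ * (p 3 * p 3) + (4 * c / Λ + (-c) * (p 0 * p 2 + p 1 * p 3)) * (p 0 * p 0), 0, 1/2;
       1/2, 0, 0, 0;
       0, 1/2, 0, 0] := by
  funext p
  ext i j
  fin_cases i <;> fin_cases j <;>
    simp [submaxMetric, fib, bpt, vform, submaxConn, Fin.sum_univ_two] <;> ring

/-- The vector fields `K₁, K₂, K₃` are Killing vector fields of the cohomogeneity-one
anti-self-dual Einstein metric associated to the submaximal projective structure
`y'' = c(xy'−y)³`; they generate its `SL(2,ℝ)` isometry group. -/
theorem submax_killing_fields (c Λ : ℝ) (hc : c ≠ 0) (hΛ : Λ ≠ 0)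
    (p : Pt4) (a b : Fin 4) :
    lieT K1 (submaxMetric c Λ) a b p = 0 ∧
    lieT K2 (submaxMetric c Λ) a b p = 0 ∧
    lieT K3 (submaxMetric c Λ) a b p = 0 := by
  rw [submaxMetric_eq]
  refine ⟨?_, ?_, ?_⟩ <;> fin_cases a <;> fin_cases b <;>
    simp (disch := fun_prop) [lieT, K1, K2, K3, Fin.sum_univ_four, pd4_coord, pd4_const,
      pd4_neg, pd4_add, pd4_mul] <;> ring
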